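/- arXiv:2603.07965 — 6 statements merged into one kernel-verified Lean document; each statement's English description precedes it below -/
import Mathlib

section
/- Per-step Lyapunov inequality (Lemma A.15). Let X ⊆ ℝ^d be nonempty, closed and convex, and let f : ℝ^d → ℝ, c : ℝ^d → ℝ^m be differentiable such that, for all x, y ∈ X: ‖∇f(x) − ∇f(y)‖ ≤ L_{∇f}‖x − y‖, ‖Dc(x) − Dc(y)‖ ≤ L_{∇c}‖x − y‖, ‖∇f(x)‖ ≤ B_{∇f}, ‖c(x)‖ ≤ B_c, ‖Dc(x)‖ ≤ B_{∇c}, and d(Dc(x)ᵀc(x), −N_X(x)) ≥ γ‖c(x)‖, where L_{∇f}, L_{∇c}, B_{∇f}, B_c, B_{∇c}, γ > 0. Set L_m = L_{∇f} + B_c L_{∇c} + B_{∇c}². Let k be an integer with k > 70 γ^{−8/3} L_m^{4/3}, set η = (1/(2L_m)) k^{−1/2}, ρ = k^{1/4}, ρ' = (k+1)^{1/4}. Let x ∈ X, ĝ ∈ ℝ^d, and x⁺ = P_X(x − η ĝ). Then (η/48) · d(∇f(x⁺) + ρ Dc(x⁺)ᵀ c(x⁺), −N_X(x⁺))² ≤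 Q_ρ(x) − Q_{ρ'}(x⁺) + (5η/8) · ‖∇Q_ρ(x) − ĝ‖² + ((ρ' − ρ)/(γ² ρ²)) · B_{∇f}². -/
open scoped RealInnerProductSpace

/-- The normal cone of a set `X` at a point `x`:
`N_X(x) = {v : ⟪v, y − x⟫ ≤ 0 for all y ∈ X}`. -/
def normalCone {E : Type*} [NormedAddCommGroup E] [InnerProductSpace ℝ E]
    (X : Set E) (x : E) : Set E :=
  {v | ∀ y ∈ X, ⟪v, y - x⟫ ≤ 0}

lemma aux_descent {E : Type*} [NormedAddCommGroup E] [InnerProductSpace ℝ E] [CompleteSpace E]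
    (X : Set E) (hX : Convex ℝ X) (Q : E → ℝ) (g : E → E) (L : ℝ)
    (hQ : ∀ x, HasGradientAt Q (g x) x)
    (hL : ∀ x ∈ X, ∀ y ∈ X, ‖g x - g y‖ ≤ L * ‖x - y‖)
    (x y : E) (hx : x ∈ X) (hy : y ∈ X) :
    Q y ≤ Q x + ⟪g x, y - x⟫ + L / 2 * ‖y - x‖ ^ 2 := by
  have hd : ∀ t : ℝ, HasDerivAt
      (fun t : ℝ => Q (x + t • (y - x)) - t * ⟪g x, y - x⟫ - L / 2 * ‖y - x‖ ^ 2 * t ^ 2)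
      (⟪g (x + t • (y - x)), y - x⟫ - ⟪g x, y - x⟫ - L * ‖y - x‖ ^ 2 * t) t := by
    intro t
    have h1 : HasDerivAt (fun t : ℝ => x + t • (y - x)) (y - x) t := by
      simpa using ((hasDerivAt_id t).smul_const (y - x)).const_add x
    have h2 := (hQ (x + t • (y - x))).hasFDerivAt.comp_hasDerivAt t h1
    have h3 := (h2.sub ((hasDerivAt_id t).mul_const ⟪g x, y - x⟫)).sub
      ((hasDerivAt_pow 2 t).const_mul (L / 2 * ‖y - x‖ ^ 2))
    refine h3.congr_deriv ?_
    simp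
    ring
  have ha := antitoneOn_of_deriv_nonpos (convex_Icc (0 : ℝ) 1)
    (fun t _ => (hd t).continuousAt.continuousWithinAt)
    (fun t _ => (hd t).differentiableAt.differentiableWithinAt)
    (by
      intro t ht
      rw [interior_Icc] at ht
      rw [(hd t).deriv]
      have hm : x + t • (y - x) ∈ X := hX.add_smul_sub_mem hx hy ⟨ht.1.le, ht.2.le⟩
      have h1 := hL _ hm _ hx
      have h2 : ‖x + t • (y - x) - x‖ = t * ‖y - x‖ := by
        rw [add_sub_cancel_left, norm_smul, Real.norm_of_nonneg ht.1.le]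
      rw [h2] at h1
      have h3 := real_inner_le_norm (g (x + t • (y - x)) - g x) (y - x)
      rw [inner_sub_left] at h3
      nlinarith [norm_nonneg (y - x)])
  have := ha (Set.left_mem_Icc.2 zero_le_one) (Set.right_mem_Icc.2 zero_le_one) zero_le_one
  simp at this
  linarith

lemma aux_grad {E F : Type*} [NormedAddCommGroup E] [InnerProductSpace ℝ E] [CompleteSpace E]
    [NormedAddCommGroup F] [InnerProductSpace ℝ F] [CompleteSpace F]
    (f : E → ℝ) (c : E → F) (hf : Differentiable ℝ f) (hc : Differentiable ℝ c) (ρ : ℝ) (x : E) :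
    HasGradientAt (fun x => f x + ρ / 2 * ‖c x‖ ^ 2)
      (gradient f x + ρ • ContinuousLinearMap.adjoint (fderiv ℝ c x) (c x)) x := by
  have h1 := (hf x).hasGradientAt.hasFDerivAt
  have h2 := ((hc x).hasFDerivAt.norm_sq).const_mul (ρ / 2)
  rw [hasGradientAt_iff_hasFDerivAt]
  refine (h1.add h2).congr_fderiv ?_
  ext v
  simp [inner_add_left, inner_smul_left, ContinuousLinearMap.adjoint_inner_left]
  ring

lemma aux_lip {E F : Type*} [NormedAddCommGroup E] [InnerProductSpace ℝ E] [CompleteSpace E]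
    [NormedAddCommGroup F] [InnerProductSpace ℝ F] [CompleteSpace F]
    (X : Set E) (hX : Convex ℝ X)
    (f : E → ℝ) (c : E → F) (hc : Differentiable ℝ c) (ρ : ℝ)
    (hρ : 1 ≤ ρ) (Lf Lc Bc Bgc : ℝ) (hLf : 0 < Lf) (hBgc : 0 < Bgc) (hBc : 0 < Bc)
    (hgradLip : ∀ x ∈ X, ∀ y ∈ X, ‖gradient f x - gradient f y‖ ≤ Lf * ‖x - y‖)
    (hJacLip : ∀ x ∈ X, ∀ y ∈ X, ‖fderiv ℝ c x - fderiv ℝ c y‖ ≤ Lc * ‖x - y‖)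
    (hcB : ∀ x ∈ X, ‖c x‖ ≤ Bc)
    (hJacB : ∀ x ∈ X, ‖fderiv ℝ c x‖ ≤ Bgc) (x : E) (hx : x ∈ X) (y : E) (hy : y ∈ X) :
    ‖(gradient f x + ρ • ContinuousLinearMap.adjoint (fderiv ℝ c x) (c x)) -
      (gradient f y + ρ • ContinuousLinearMap.adjoint (fderiv ℝ c y) (c y))‖ ≤
      (ρ * (Lf + Bc * Lc + Bgc ^ 2)) * ‖x - y‖ := by
  have hcl : ‖c x - c y‖ ≤ Bgc * ‖x - y‖ :=
    hX.norm_image_sub_le_of_norm_fderiv_le (fun z _ => hc z) hJacB hy hx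
  set A := fderiv ℝ c x
  set B := fderiv ℝ c y
  have e : (gradient f x + ρ • ContinuousLinearMap.adjoint A (c x)) -
      (gradient f y + ρ • ContinuousLinearMap.adjoint B (c y)) =
      (gradient f x - gradient f y) + ρ • (ContinuousLinearMap.adjoint (A - B) (c x) +
        ContinuousLinearMap.adjoint B (c x - c y)) := by
    simp only [map_sub, ContinuousLinearMap.sub_apply]
    module
  rw [e]
  have h1 : ‖ContinuousLinearMap.adjoint (A - B) (c x)‖ ≤ (Lc * ‖x - y‖) * Bc := by
    refine (ContinuousLinearMap.le_opNorm _ _).trans ?_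
    rw [LinearIsometryEquiv.norm_map]
    exact mul_le_mul (hJacLip x hx y hy) (hcB x hx) (norm_nonneg _)
      ((norm_nonneg _).trans (hJacLip x hx y hy))
  have h2 : ‖ContinuousLinearMap.adjoint B (c x - c y)‖ ≤ Bgc * (Bgc * ‖x - y‖) := by
    refine (ContinuousLinearMap.le_opNorm _ _).trans ?_
    rw [LinearIsometryEquiv.norm_map]
    exact mul_le_mul (hJacB y hy) hcl (norm_nonneg _) hBgc.le
  refine (norm_add_le _ _).trans ?_
  rw [norm_smul, Real.norm_of_nonneg (by linarith)]
  have h3 := (norm_add_le (ContinuousLinearMap.adjoint (A - B) (c x))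
    (ContinuousLinearMap.adjoint B (c x - c y))).trans (add_le_add h1 h2)
  have h4 := mul_le_mul_of_nonneg_left h3 (by linarith : (0:ℝ) ≤ ρ)
  have h5 := hgradLip x hx y hy
  have h6 : 0 ≤ (ρ - 1) * (Lf * ‖x - y‖) :=
    mul_nonneg (by linarith) (mul_nonneg hLf.le (norm_nonneg _))
  nlinarith

lemma aux_reg {E : Type*} [NormedAddCommGroup E] [InnerProductSpace ℝ E]
    (X : Set E) (x a u : E) (ρ t B : ℝ) (hρ : 0 < ρ)
    (ha : ‖a‖ ≤ B) (h : t ≤ Metric.infDist u (-(normalCone X x))) :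
    ρ * t ≤ Metric.infDist (a + ρ • u) (-(normalCone X x)) + B := by
  have hne : (-(normalCone X x)).Nonempty := ⟨0, by simp [normalCone]⟩
  rw [← sub_le_iff_le_add]
  refine (Metric.le_infDist hne).2 ?_
  intro s hs
  have hs' : ρ⁻¹ • s ∈ -(normalCone X x) := by
    intro y hy
    have := hs y hy
    rw [← smul_neg, inner_smul_left]
    exact mul_nonpos_of_nonneg_of_nonpos (by simpa using hρ.le) this
  have h1 := h.trans (Metric.infDist_le_dist_of_mem hs')
  rw [dist_eq_norm] at h1 ⊢
  have e : ρ • (u - ρ⁻¹ • s) = (a + ρ • u - s) - a := by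
    rw [smul_sub, smul_inv_smul₀ hρ.ne']; abel
  have h2 : ρ * ‖u - ρ⁻¹ • s‖ = ‖(a + ρ • u - s) - a‖ := by
    rw [← e, norm_smul, Real.norm_of_nonneg hρ.le]
  have h3 := norm_sub_le (a + ρ • u - s) a
  have h4 := mul_le_mul_of_nonneg_left h1 hρ.le
  linarith

lemma aux_num (γ Lm : ℝ) (hγ : 0 < γ) (hLm : 0 < Lm) (k : ℕ)
    (hk : 70 * γ ^ (-(8 : ℝ) / 3) * Lm ^ ((4 : ℝ) / 3) < (k : ℝ)) (η ρ ρ' : ℝ)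
    (hη : η = (1 / (2 * Lm)) * (k : ℝ) ^ (-(1 : ℝ) / 2))
    (hρ : ρ = (k : ℝ) ^ ((1 : ℝ) / 4))
    (hρ' : ρ' = ((k : ℝ) + 1) ^ ((1 : ℝ) / 4)) :
    1 ≤ ρ ∧ 0 < η ∧ η * (ρ * Lm) ≤ 1 / 2 ∧ ρ ≤ ρ' ∧ (ρ' - ρ) / (γ ^ 2 * ρ ^ 2) ≤ η / 48 := by
  have hk0 : (0:ℝ) < k := lt_of_le_of_lt (by positivity) hk
  have hk1 : (1:ℝ) ≤ k := by
    have : 0 < k := by exact_mod_cast hk0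
    exact_mod_cast this
  have h1 : 1 ≤ ρ := by rw [hρ]; exact Real.one_le_rpow hk1 (by norm_num)
  have hρ0 : 0 < ρ := by linarith
  have hρ4 : ρ ^ 4 = k := by
    rw [hρ, ← Real.rpow_natCast, ← Real.rpow_mul hk0.le]; norm_num
  have hρ4' : ρ' ^ 4 = k + 1 := by
    rw [hρ', ← Real.rpow_natCast, ← Real.rpow_mul (by linarith)]; norm_num
  have hle : ρ ≤ ρ' := by
    rw [hρ, hρ']; exact Real.rpow_le_rpow hk0.le (by linarith) (by norm_num)
  have hη' : η = 1 / (2 * Lm * ρ ^ 2) := by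
    have : (k : ℝ) ^ (-(1 : ℝ) / 2) = (ρ ^ 2)⁻¹ := by
      rw [hρ, ← Real.rpow_natCast, ← Real.rpow_mul hk0.le, ← Real.rpow_neg hk0.le]; norm_num
    rw [hη, this]; field_simp
  have hη0 : 0 < η := by rw [hη']; positivity
  have h24 : 24 * Lm ≤ γ ^ 2 * ρ ^ 3 := by
    have hc : (70 * γ ^ (-(8 : ℝ) / 3) * Lm ^ ((4 : ℝ) / 3)) ^ 3 < (k : ℝ) ^ 3 :=
      pow_lt_pow_left₀ hk (by positivity) (by norm_num)
    have e1 : (γ ^ (-(8 : ℝ) / 3)) ^ 3 = (γ ^ 8)⁻¹ := by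
      rw [← Real.rpow_natCast, ← Real.rpow_mul hγ.le, ← Real.rpow_natCast,
        ← Real.rpow_neg hγ.le]; norm_num
    have e2 : (Lm ^ ((4 : ℝ) / 3)) ^ 3 = Lm ^ 4 := by
      rw [← Real.rpow_natCast, ← Real.rpow_mul hLm.le, ← Real.rpow_natCast]; norm_num
    rw [mul_pow, mul_pow, e1, e2, ← hρ4] at hc
    have hc2 : 70 ^ 3 * Lm ^ 4 < γ ^ 8 * (ρ ^ 4) ^ 3 := by
      have := mul_lt_mul_of_pos_left hc (by positivity : 0 < γ ^ 8)
      have e : γ ^ 8 * (70 ^ 3 * (γ ^ 8)⁻¹ * Lm ^ 4) = 70 ^ 3 * Lm ^ 4 := by field_simp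
      rwa [e] at this
    refine le_of_pow_le_pow_left₀ (n := 4) (by norm_num) (by positivity) ?_
    have : 0 < Lm ^ 4 := by positivity
    calc (24 * Lm) ^ 4 ≤ 70 ^ 3 * Lm ^ 4 := by rw [mul_pow]; nlinarith
      _ ≤ γ ^ 8 * (ρ ^ 4) ^ 3 := hc2.le
      _ = (γ ^ 2 * ρ ^ 3) ^ 4 := by ring
  have hdiff : (ρ' - ρ) * (4 * ρ ^ 3) ≤ 1 := by
    have e : (ρ' - ρ) * (ρ' ^ 3 + ρ' ^ 2 * ρ + ρ' * ρ ^ 2 + ρ ^ 3) = 1 := by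
      linear_combination hρ4' - hρ4
    have h3 : ρ ^ 3 ≤ ρ' ^ 3 := by gcongr
    have h2 : ρ ^ 2 * ρ ≤ ρ' ^ 2 * ρ := by gcongr
    have h1 : ρ * ρ ^ 2 ≤ ρ' * ρ ^ 2 := by gcongr
    rw [← e]
    exact mul_le_mul_of_nonneg_left (by nlinarith) (by linarith)
  refine ⟨h1, hη0, ?_, hle, ?_⟩
  · rw [hη']
    have : 1 / (2 * Lm * ρ ^ 2) * (ρ * Lm) = 1 / (2 * ρ) := by field_simp
    rw [this, div_le_div_iff₀ (by positivity) (by norm_num)]; linarith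
  · rw [hη', div_div, div_le_div_iff₀ (by positivity) (by positivity)]
    have := mul_le_mul_of_nonneg_left h24 (by linarith : 0 ≤ ρ' - ρ)
    have h5 := mul_le_mul_of_nonneg_left hdiff (by positivity : 0 ≤ γ ^ 2)
    have h6 : (ρ' - ρ) * (96 * Lm) ≤ γ ^ 2 := by linarith
    nlinarith [mul_le_mul_of_nonneg_left h6 (by positivity : 0 ≤ ρ ^ 2)]

/-- Per-step Lyapunov inequality (Lemma A.15) for the quadratic penalty
`Q_ρ(x) = f(x) + (ρ/2)‖c(x)‖²` with gradient `∇Q_ρ(x) = ∇f(x) + ρ Dc(x)ᵀc(x)`: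
under the stated smoothness, boundedness and regularity conditions on the closed
convex set `X`, with `L_m = L_{∇f} + B_c L_{∇c} + B_{∇c}²`,
`k > 70 γ^{−8/3} L_m^{4/3}`, `η = (1/(2L_m)) k^{−1/2}`, `ρ = k^{1/4}`,
`ρ' = (k+1)^{1/4}`, `x ∈ X` and `x⁺ = P_X(x − η ĝ)`, one has
`(η/48) d(∇f(x⁺) + ρ Dc(x⁺)ᵀc(x⁺), −N_X(x⁺))²
  ≤ Q_ρ(x) − Q_{ρ'}(x⁺) + (5η/8)‖∇Q_ρ(x) − ĝ‖² + ((ρ'−ρ)/(γ²ρ²)) B_{∇f}²`. -/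
theorem per_step_lyapunov_inequality (d m : ℕ)
    (X : Set (EuclideanSpace ℝ (Fin d)))
    (hXne : X.Nonempty) (hXcl : IsClosed X) (hXconv : Convex ℝ X)
    (f : EuclideanSpace ℝ (Fin d) → ℝ)
    (c : EuclideanSpace ℝ (Fin d) → EuclideanSpace ℝ (Fin m))
    (hf : Differentiable ℝ f) (hc : Differentiable ℝ c)
    (Lf Lc Bgf Bc Bgc γ : ℝ)
    (hLf : 0 < Lf) (hLc : 0 < Lc) (hBgf : 0 < Bgf) (hBc : 0 < Bc) (hBgc : 0 < Bgc)
    (hγ : 0 < γ)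
    (hgradLip : ∀ x ∈ X, ∀ y ∈ X, ‖gradient f x - gradient f y‖ ≤ Lf * ‖x - y‖)
    (hJacLip : ∀ x ∈ X, ∀ y ∈ X, ‖fderiv ℝ c x - fderiv ℝ c y‖ ≤ Lc * ‖x - y‖)
    (hgfB : ∀ x ∈ X, ‖gradient f x‖ ≤ Bgf)
    (hcB : ∀ x ∈ X, ‖c x‖ ≤ Bc)
    (hJacB : ∀ x ∈ X, ‖fderiv ℝ c x‖ ≤ Bgc)
    (hreg : ∀ x ∈ X, γ * ‖c x‖ ≤
      Metric.infDist (ContinuousLinearMap.adjoint (fderiv ℝ c x) (c x)) (-(normalCone X x)))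
    (Lm : ℝ) (hLm : Lm = Lf + Bc * Lc + Bgc ^ 2)
    (k : ℕ) (hk : 70 * γ ^ (-(8 : ℝ) / 3) * Lm ^ ((4 : ℝ) / 3) < (k : ℝ))
    (η ρ ρ' : ℝ)
    (hη : η = (1 / (2 * Lm)) * (k : ℝ) ^ (-(1 : ℝ) / 2))
    (hρ : ρ = (k : ℝ) ^ ((1 : ℝ) / 4))
    (hρ' : ρ' = ((k : ℝ) + 1) ^ ((1 : ℝ) / 4))
    (x : EuclideanSpace ℝ (Fin d)) (hx : x ∈ X)
    (ghat : EuclideanSpace ℝ (Fin d))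
    (xp : EuclideanSpace ℝ (Fin d)) (hxpX : xp ∈ X)
    (hproj : ∀ y ∈ X, ‖xp - (x - η • ghat)‖ ≤ ‖y - (x - η • ghat)‖) :
    (η / 48) *
        (Metric.infDist
          (gradient f xp + ρ • ContinuousLinearMap.adjoint (fderiv ℝ c xp) (c xp))
          (-(normalCone X xp))) ^ 2
      ≤ (f x + ρ / 2 * ‖c x‖ ^ 2) - (f xp + ρ' / 2 * ‖c xp‖ ^ 2)
        + (5 * η / 8) *
          ‖(gradient f x + ρ • ContinuousLinearMap.adjoint (fderiv ℝ c x) (c x)) - ghat‖ ^ 2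
        + ((ρ' - ρ) / (γ ^ 2 * ρ ^ 2)) * Bgf ^ 2 := by
  have hLm0 : 0 < Lm := by rw [hLm]; positivity
  obtain ⟨h1, hη0, hηL, hle, hq⟩ := aux_num γ Lm hγ hLm0 k hk η ρ ρ' hη hρ hρ'
  clear hη hρ hρ' hk
  have hρ0 : 0 < ρ := by linarith
  have hlip := aux_lip X hXconv f c hc ρ h1 Lf Lc Bc Bgc hLf hBgc hBc hgradLip hJacLip hcB hJacB
  rw [← hLm] at hlip
  have hdes := aux_descent X hXconv _ _ _ (aux_grad f c hf hc ρ) hlip x xp hx hxpX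
  have hr := aux_reg X xp (gradient f xp) _ ρ _ Bgf hρ0 (hgfB xp hxpX) (hreg xp hxpX)
  have hlx := hlip xp hxpX x hx
  set gx := gradient f x + ρ • ContinuousLinearMap.adjoint (fderiv ℝ c x) (c x)
  set gp := gradient f xp + ρ • ContinuousLinearMap.adjoint (fderiv ℝ c xp) (c xp)
  set D := Metric.infDist gp (-(normalCone X xp)) with hD
  have hD0 : 0 ≤ D := Metric.infDist_nonneg
  -- optimality
  have hopt : ∀ y ∈ X, ⟪(x - η • ghat) - xp, y - xp⟫ ≤ 0 := by
    refine (norm_eq_iInf_iff_real_inner_le_zero hXconv hxpX).1 ?_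
    haveI : Nonempty X := ⟨⟨xp, hxpX⟩⟩
    refine le_antisymm (le_ciInf fun y => ?_) (ciInf_le ⟨0, ?_⟩ (⟨xp, hxpX⟩ : X))
    · rw [norm_sub_rev, norm_sub_rev _ (y : EuclideanSpace ℝ (Fin d))]
      exact hproj y y.2
    · rintro _ ⟨y, rfl⟩
      exact norm_nonneg _
  obtain ⟨s, hs⟩ : ∃ s, s = ‖xp - x‖ / η := ⟨_, rfl⟩
  have hs0 : 0 ≤ s := by rw [hs]; positivity
  have hrs : ‖xp - x‖ = η * s := by rw [hs]; field_simp
  have hDle : D ≤ 3 / 2 * s + ‖gx - ghat‖ := by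
    have hmem : -(η⁻¹ • ((x - η • ghat) - xp)) ∈ -(normalCone X xp) := by
      intro y hy
      rw [neg_neg, inner_smul_left]
      exact mul_nonpos_of_nonneg_of_nonpos (by simpa using hη0.le) (hopt y hy)
    have h := Metric.infDist_le_dist_of_mem (x := gp) hmem
    rw [dist_eq_norm] at h
    have e : gp - -(η⁻¹ • ((x - η • ghat) - xp)) =
        (gp - gx) + (gx - ghat) + η⁻¹ • (x - xp) := by
      have : η⁻¹ • (η • ghat) = ghat := inv_smul_smul₀ hη0.ne' _
      simp only [smul_sub, this]
      abel
    rw [e] at h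
    have h2 := norm_add₃_le (a := gp - gx) (b := gx - ghat) (c := η⁻¹ • (x - xp))
    rw [norm_smul, norm_sub_rev x xp, hrs, Real.norm_of_nonneg (by positivity),
      inv_mul_cancel_left₀ hη0.ne'] at h2
    rw [hrs] at hlx
    have h3 := mul_le_mul_of_nonneg_right hηL hs0
    linarith
  have hin : ⟪gx, xp - x⟫ ≤ ‖gx - ghat‖ * (η * s) - η * s ^ 2 := by
    have h := hopt x hx
    have e : (x - η • ghat) - xp = (x - xp) - η • ghat := by abel
    rw [e, inner_sub_left, real_inner_self_eq_norm_sq, norm_sub_rev, hrs, inner_smul_left,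
      ← neg_sub xp x, inner_neg_right] at h
    simp only [conj_trivial] at h
    have h2 := real_inner_le_norm (gx - ghat) (xp - x)
    rw [hrs, inner_sub_left] at h2
    have h3 : ⟪ghat, xp - x⟫ ≤ - (η * s ^ 2) := by
      refine le_of_mul_le_mul_left ?_ hη0
      nlinarith
    linarith
  rw [hrs] at hdes
  have hdes2 : ρ * Lm / 2 * (η * s) ^ 2 ≤ η * s ^ 2 / 4 := by
    nlinarith [mul_le_mul_of_nonneg_right hηL (by positivity : 0 ≤ η * s ^ 2)]
  generalize ‖gx - ghat‖ = e at *
  have hcsq : (ρ' - ρ) / 2 * ‖c xp‖ ^ 2 ≤ (ρ' - ρ) / (γ ^ 2 * ρ ^ 2) * (D ^ 2 + Bgf ^ 2) := by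
    have h2 : (ρ * (γ * ‖c xp‖)) ^ 2 ≤ (D + Bgf) ^ 2 :=
      pow_le_pow_left₀ (by positivity) hr 2
    have h3 : ‖c xp‖ ^ 2 * (γ ^ 2 * ρ ^ 2) ≤ 2 * (D ^ 2 + Bgf ^ 2) := by
      nlinarith [sq_nonneg (D - Bgf)]
    have h4 : ‖c xp‖ ^ 2 ≤ 2 * (D ^ 2 + Bgf ^ 2) / (γ ^ 2 * ρ ^ 2) := by
      rwa [le_div_iff₀ (by positivity)]
    calc _ ≤ (ρ' - ρ) / 2 * (2 * (D ^ 2 + Bgf ^ 2) / (γ ^ 2 * ρ ^ 2)) :=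
          mul_le_mul_of_nonneg_left h4 (by linarith)
      _ = _ := by ring
  have hDsq : D ^ 2 ≤ (3 / 2 * s + e) ^ 2 := pow_le_pow_left₀ hD0 hDle 2
  have hqD := mul_le_mul_of_nonneg_right hq (sq_nonneg D)
  have hfin : η / 24 * D ^ 2 ≤ η * (3 / 4 * s ^ 2 - e * s + 5 / 8 * e ^ 2) := by
    have : D ^ 2 / 24 ≤ 3 / 4 * s ^ 2 - e * s + 5 / 8 * e ^ 2 := by
      linarith [sq_nonneg (s - 6 / 7 * e), sq_nonneg e]
    linarith [mul_le_mul_of_nonneg_left this hη0.le]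
  linarith
end

section
/- Stationarity residual after one inexact projected gradient step (Lemma A.12). Let X ⊆ ℝ^d be nonempty, closed and convex, let Q : ℝ^d → ℝ be differentiable with ‖∇Q(u) − ∇Q(v)‖ ≤ L‖u − v‖ for all u, v ∈ X, let η > 0 satisfy η L ≤ 1, let ĝ ∈ ℝ^d, let x ∈ X, and let x⁺ = P_X(x − η ĝ). Then d(∇Q(x⁺), −N_X(x⁺))² ≤ 6 η^{−2} ‖x⁺ − x‖² + 3 ‖∇Q(x) − ĝ‖². -/
open scoped RealInnerProductSpace

/-- Stationarity residual after one inexact projected gradient step (Lemma A.12):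
if `Q` is differentiable with `L`-Lipschitz gradient on the nonempty closed convex
set `X`, `η > 0` with `ηL ≤ 1`, `x ∈ X` and `x⁺ = P_X(x − η ĝ)`, then
`d(∇Q(x⁺), −N_X(x⁺))² ≤ 6 η⁻² ‖x⁺ − x‖² + 3 ‖∇Q(x) − ĝ‖²`. -/
theorem stationarity_residual_one_step (d : ℕ)
    (X : Set (EuclideanSpace ℝ (Fin d)))
    (hXne : X.Nonempty) (hXcl : IsClosed X) (hXconv : Convex ℝ X)
    (Q : EuclideanSpace ℝ (Fin d) → ℝ) (hQ : Differentiable ℝ Q)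
    (L : ℝ)
    (hLip : ∀ u ∈ X, ∀ v ∈ X, ‖gradient Q u - gradient Q v‖ ≤ L * ‖u - v‖)
    (η : ℝ) (hη : 0 < η) (hηL : η * L ≤ 1)
    (ghat : EuclideanSpace ℝ (Fin d))
    (x : EuclideanSpace ℝ (Fin d)) (hx : x ∈ X)
    (xp : EuclideanSpace ℝ (Fin d)) (hxpX : xp ∈ X)
    (hproj : ∀ y ∈ X, ‖xp - (x - η • ghat)‖ ≤ ‖y - (x - η • ghat)‖) :
    (Metric.infDist (gradient Q xp) (-(normalCone X xp))) ^ 2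
      ≤ 6 * η⁻¹ ^ 2 * ‖xp - x‖ ^ 2 + 3 * ‖gradient Q x - ghat‖ ^ 2 := by
  have hvar : ∀ y ∈ X, ⟪(x - η • ghat) - xp, y - xp⟫ ≤ 0 := by
    refine (norm_eq_iInf_iff_real_inner_le_zero hXconv hxpX).1 ?_
    haveI : Nonempty X := ⟨⟨x, hx⟩⟩
    apply le_antisymm
    · refine le_ciInf fun w => ?_
      rw [norm_sub_rev, norm_sub_rev _ (w : EuclideanSpace ℝ (Fin d))]
      exact hproj w w.2
    · exact ciInf_le (f := fun w : X => ‖(x - η • ghat) - (w : EuclideanSpace ℝ (Fin d))‖)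
        ⟨0, by rintro _ ⟨w, rfl⟩; exact norm_nonneg _⟩ ⟨xp, hxpX⟩
  have hmem : η⁻¹ • (xp - x) + ghat ∈ -(normalCone X xp) := by
    rw [Set.mem_neg]
    intro y hy
    have e : -(η⁻¹ • (xp - x) + ghat) = η⁻¹ • ((x - η • ghat) - xp) := by
      have : η⁻¹ • η • ghat = ghat := inv_smul_smul₀ hη.ne' ghat
      simp only [smul_sub, this]
      abel
    rw [e, real_inner_smul_left]
    exact mul_nonpos_of_nonneg_of_nonpos (inv_nonneg.2 hη.le) (hvar y hy)
  have h1 := Metric.infDist_le_dist_of_mem (x := gradient Q xp) hmem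
  have h0 : 0 ≤ Metric.infDist (gradient Q xp) (-(normalCone X xp)) := Metric.infDist_nonneg
  have hL : L ≤ η⁻¹ := by
    rw [← one_div, le_div_iff₀ hη]; linarith
  have h2 : ‖gradient Q xp - gradient Q x‖ ≤ η⁻¹ * ‖xp - x‖ :=
    (hLip xp hxpX x hx).trans (mul_le_mul_of_nonneg_right hL (norm_nonneg _))
  have h3 : dist (gradient Q xp) (η⁻¹ • (xp - x) + ghat)
      ≤ η⁻¹ * ‖xp - x‖ + ‖gradient Q x - ghat‖ + η⁻¹ * ‖xp - x‖ := by
    have e : gradient Q xp - (η⁻¹ • (xp - x) + ghat)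
        = (gradient Q xp - gradient Q x) + (gradient Q x - ghat) - η⁻¹ • (xp - x) := by abel
    have hn : ‖η⁻¹ • (xp - x)‖ = η⁻¹ * ‖xp - x‖ := by
      rw [norm_smul, Real.norm_of_nonneg (inv_nonneg.2 hη.le)]
    rw [dist_eq_norm, e]
    have a1 := norm_sub_le ((gradient Q xp - gradient Q x) + (gradient Q x - ghat))
      (η⁻¹ • (xp - x))
    have a2 := norm_add_le (gradient Q xp - gradient Q x) (gradient Q x - ghat)
    linarith
  have h4 := pow_le_pow_left₀ h0 (h1.trans h3) 2
  refine h4.trans ?_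
  rw [mul_assoc, ← mul_pow]
  nlinarith [sq_nonneg (η⁻¹ * ‖xp - x‖ - ‖gradient Q x - ghat‖)]
end

section
/- Change of penalty function under penalty increase (Lemma A.13). Let X ⊆ ℝ^d be nonempty, closed and convex, let f : ℝ^d → ℝ and c : ℝ^d → ℝ^m be differentiable, let x ∈ X, let B_{∇f} > 0 satisfy ‖∇f(x)‖ ≤ B_{∇f}, let γ > 0 satisfy d(Dc(x)ᵀc(x), −N_X(x)) ≥ γ‖c(x)‖, and let 0 < ρ ≤ ρ'. Then Q_{ρ'}(x) − Q_ρ(x) ≤ ((ρ' − ρ)/(γ² ρ²)) · B_{∇f}² + ((ρ' − ρ)/(γ² ρ²)) · d(∇f(x) + ρ Dc(x)ᵀc(x), −N_X(x))². -/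
open scoped RealInnerProductSpace

/-- Change of the quadratic penalty `Q_ρ(x) = f(x) + (ρ/2)‖c(x)‖²` under a penalty
increase (Lemma A.13): if `‖∇f(x)‖ ≤ B_{∇f}`, the regularity condition
`d(Dc(x)ᵀc(x), −N_X(x)) ≥ γ‖c(x)‖` holds and `0 < ρ ≤ ρ'`, then
`Q_{ρ'}(x) − Q_ρ(x) ≤ ((ρ'−ρ)/(γ²ρ²)) B_{∇f}²
  + ((ρ'−ρ)/(γ²ρ²)) d(∇f(x) + ρ Dc(x)ᵀc(x), −N_X(x))²`. -/
theorem penalty_change_under_increase (d m : ℕ)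
    (X : Set (EuclideanSpace ℝ (Fin d)))
    (hXne : X.Nonempty) (hXcl : IsClosed X) (hXconv : Convex ℝ X)
    (f : EuclideanSpace ℝ (Fin d) → ℝ)
    (c : EuclideanSpace ℝ (Fin d) → EuclideanSpace ℝ (Fin m))
    (hf : Differentiable ℝ f) (hc : Differentiable ℝ c)
    (x : EuclideanSpace ℝ (Fin d)) (hx : x ∈ X)
    (Bgf : ℝ) (hBgf : 0 < Bgf) (hgf : ‖gradient f x‖ ≤ Bgf)
    (γ : ℝ) (hγ : 0 < γ)
    (hreg : γ * ‖c x‖ ≤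
      Metric.infDist (ContinuousLinearMap.adjoint (fderiv ℝ c x) (c x)) (-(normalCone X x)))
    (ρ ρ' : ℝ) (hρ : 0 < ρ) (hρρ' : ρ ≤ ρ') :
    (f x + ρ' / 2 * ‖c x‖ ^ 2) - (f x + ρ / 2 * ‖c x‖ ^ 2)
      ≤ ((ρ' - ρ) / (γ ^ 2 * ρ ^ 2)) * Bgf ^ 2
        + ((ρ' - ρ) / (γ ^ 2 * ρ ^ 2)) *
          (Metric.infDist
            (gradient f x + ρ • ContinuousLinearMap.adjoint (fderiv ℝ c x) (c x))
            (-(normalCone X x))) ^ 2 := by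
  set v := ContinuousLinearMap.adjoint (fderiv ℝ c x) (c x) with hv
  set g := gradient f x with hg
  set S := -(normalCone X x) with hS
  have hmem : ∀ s, s ∈ S ↔ ∀ y ∈ X, ⟪-s, y - x⟫ ≤ 0 := by
    intro s
    rw [hS]
    exact Iff.rfl
  have hne : S.Nonempty := ⟨0, by rw [hmem]; intro y _; simp⟩
  have key : ρ * (γ * ‖c x‖) - Bgf ≤ Metric.infDist (g + ρ • v) S := by
    rw [Metric.le_infDist hne]
    intro s hs
    have h1 : ρ⁻¹ • s ∈ S := by
      rw [hmem] at hs ⊢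
      intro y hy
      have h := hs y hy
      rw [← smul_neg, real_inner_smul_left]
      exact mul_nonpos_of_nonneg_of_nonpos (inv_nonneg.2 hρ.le) h
    have h2 := hreg.trans (Metric.infDist_le_dist_of_mem h1)
    have h3 : ρ * dist v (ρ⁻¹ • s) = ‖ρ • v - s‖ := by
      rw [dist_eq_norm, ← abs_of_pos hρ, ← Real.norm_eq_abs, ← norm_smul, Real.norm_eq_abs,
        abs_of_pos hρ, smul_sub, smul_inv_smul₀ hρ.ne']
    have h4 : ‖ρ • v - s‖ ≤ ‖g + ρ • v - s‖ + ‖g‖ := by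
      have : ρ • v - s = (g + ρ • v - s) - g := by abel
      rw [this]
      exact norm_sub_le _ _
    have h5 := mul_le_mul_of_nonneg_left h2 hρ.le
    rw [dist_eq_norm]
    linarith
  have h0 : 0 ≤ ρ * (γ * ‖c x‖) := by positivity
  have hD := Metric.infDist_nonneg (x := g + ρ • v) (s := S)
  generalize Metric.infDist (g + ρ • v) S = D at *
  have h6 : (ρ * (γ * ‖c x‖)) ^ 2 ≤ 2 * (Bgf ^ 2 + D ^ 2) := by
    nlinarith [sq_nonneg (Bgf - D)]
  have h7 : ‖c x‖ ^ 2 / 2 ≤ (Bgf ^ 2 + D ^ 2) / (γ ^ 2 * ρ ^ 2) := by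
    rw [le_div_iff₀ (by positivity)]
    nlinarith
  have h8 := mul_le_mul_of_nonneg_left h7 (sub_nonneg.2 hρρ')
  calc _ = (ρ' - ρ) * (‖c x‖ ^ 2 / 2) := by ring
    _ ≤ _ := h8
    _ = _ := by ring
end

section
/- Descent lemma for an inexact projected gradient step (Lemma A.14). Let X ⊆ ℝ^d be nonempty, closed and convex, let Q : ℝ^d → ℝ be differentiable with ‖∇Q(u) − ∇Q(v)‖ ≤ L‖u − v‖ for all u, v ∈ X where L > 0, let 0 < η ≤ 1/(2L), let ĝ ∈ ℝ^d, let x ∈ X, and let x⁺ = P_X(x − η ĝ). Then Q(x⁺) − Q(x) ≤ (η/2) ‖∇Q(x) − ĝ‖² − (1/(4η)) ‖x⁺ − x‖². -/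
/-- Descent lemma for an inexact projected gradient step (Lemma A.14):
if `Q` is differentiable with `L`-Lipschitz gradient on the nonempty closed convex
set `X`, `0 < η ≤ 1/(2L)`, `x ∈ X` and `x⁺ = P_X(x − η ĝ)`, then
`Q(x⁺) − Q(x) ≤ (η/2) ‖∇Q(x) − ĝ‖² − (1/(4η)) ‖x⁺ − x‖²`. -/
theorem descent_lemma_inexact_projected_step (d : ℕ)
    (X : Set (EuclideanSpace ℝ (Fin d)))
    (hXne : X.Nonempty) (hXcl : IsClosed X) (hXconv : Convex ℝ X)
    (Q : EuclideanSpace ℝ (Fin d) → ℝ) (hQ : Differentiable ℝ Q)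
    (L : ℝ) (hL : 0 < L)
    (hLip : ∀ u ∈ X, ∀ v ∈ X, ‖gradient Q u - gradient Q v‖ ≤ L * ‖u - v‖)
    (η : ℝ) (hη : 0 < η) (hηL : η ≤ 1 / (2 * L))
    (ghat : EuclideanSpace ℝ (Fin d))
    (x : EuclideanSpace ℝ (Fin d)) (hx : x ∈ X)
    (xp : EuclideanSpace ℝ (Fin d)) (hxpX : xp ∈ X)
    (hproj : ∀ y ∈ X, ‖xp - (x - η • ghat)‖ ≤ ‖y - (x - η • ghat)‖) :
    Q xp - Q x ≤ (η / 2) * ‖gradient Q x - ghat‖ ^ 2 - (1 / (4 * η)) * ‖xp - x‖ ^ 2 := by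
  have hvar : inner ℝ ((x - η • ghat) - xp) (x - xp) ≤ 0 := by
    refine (norm_eq_iInf_iff_real_inner_le_zero hXconv hxpX).1 ?_ x hx
    have : Nonempty X := ⟨⟨x, hx⟩⟩
    apply le_antisymm
    · apply le_ciInf
      intro w
      rw [norm_sub_rev, norm_sub_rev _ (w : EuclideanSpace ℝ (Fin d))]
      exact hproj w w.2
    · exact ciInf_le (f := fun w : X => ‖(x - η • ghat) - (w : EuclideanSpace ℝ (Fin d))‖)
        ⟨0, by rintro _ ⟨w, rfl⟩; exact norm_nonneg _⟩ ⟨xp, hxpX⟩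
  obtain ⟨D, rfl⟩ : ∃ D, xp = x + D := ⟨xp - x, by abel⟩
  have hder : ∀ t : ℝ, HasDerivAt (fun t : ℝ => Q (x + t • D) - t * inner ℝ (gradient Q x) D
      - L / 2 * ‖D‖ ^ 2 * t ^ 2)
      (inner ℝ (gradient Q (x + t • D)) D - inner ℝ (gradient Q x) D - L * ‖D‖ ^ 2 * t) t := by
    intro t
    have h1 : HasDerivAt (fun t : ℝ => x + t • D) D t := by
      simpa using ((hasDerivAt_id t).smul_const D).const_add x
    have h2 := (hQ (x + t • D)).hasGradientAt.hasFDerivAt.comp_hasDerivAt t h1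
    have h3 := (hasDerivAt_id t).mul_const (inner ℝ (gradient Q x) D)
    have h4 := (hasDerivAt_pow 2 t).const_mul (L / 2 * ‖D‖ ^ 2)
    refine ((h2.sub h3).sub h4).congr_deriv ?_
    simp
    ring
  obtain ⟨c, hc, hceq⟩ := exists_hasDerivAt_eq_slope _ _ (zero_lt_one' ℝ)
    (fun t _ => (hder t).continuousAt.continuousWithinAt) (fun t _ => hder t)
  have hcX : x + c • D ∈ X := by
    have := hXconv.add_smul_sub_mem hx hxpX ⟨hc.1.le, hc.2.le⟩
    simpa using this
  have hb : inner ℝ (gradient Q (x + c • D)) D - inner ℝ (gradient Q x) D ≤ L * ‖D‖ ^ 2 * c := by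
    rw [← inner_sub_left]
    refine (real_inner_le_norm _ _).trans ?_
    have := hLip _ hcX _ hx
    rw [add_sub_cancel_left, norm_smul, Real.norm_of_nonneg hc.1.le] at this
    nlinarith [mul_le_mul_of_nonneg_right this (norm_nonneg D)]
  have hdesc : Q (x + D) - Q x ≤ inner ℝ (gradient Q x) D + L / 2 * ‖D‖ ^ 2 := by
    simp at hceq hb ⊢
    linarith
  have hv : ‖D‖ ^ 2 + η * inner ℝ ghat D ≤ 0 := by
    have e1 : (x - η • ghat) - (x + D) = -(D + η • ghat) := by abel
    have e2 : x - (x + D) = -D := by abel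
    rw [e1, e2, inner_neg_neg, inner_add_left, real_inner_self_eq_norm_sq,
      real_inner_smul_left] at hvar
    exact hvar
  have hy : 2 * η * inner ℝ (gradient Q x - ghat) D ≤ η ^ 2 * ‖gradient Q x - ghat‖ ^ 2 + ‖D‖ ^ 2 := by
    nlinarith [real_inner_le_norm (gradient Q x - ghat) D,
      sq_nonneg (η * ‖gradient Q x - ghat‖ - ‖D‖)]
  rw [inner_sub_left] at hy
  have hLη : 2 * L * η ≤ 1 := by
    rw [le_div_iff₀ (by positivity)] at hηL
    linarith
  rw [add_sub_cancel_left]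
  have hLD := mul_le_mul_of_nonneg_right hLη (sq_nonneg ‖D‖)
  have hd := mul_le_mul_of_nonneg_left hdesc hη.le
  have : η * (Q (x + D) - Q x) ≤
      η * ((η / 2) * ‖gradient Q x - ghat‖ ^ 2 - (1 / (4 * η)) * ‖D‖ ^ 2) := by
    have e : η * ((η / 2) * ‖gradient Q x - ghat‖ ^ 2 - (1 / (4 * η)) * ‖D‖ ^ 2)
        = η ^ 2 / 2 * ‖gradient Q x - ghat‖ ^ 2 - ‖D‖ ^ 2 / 4 := by
      field_simp
    rw [e]
    linarith
  exact le_of_mul_le_mul_left this hη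
end

section
/- Feasibility residual bound from the regularity condition (step ① of the feasibility part of the proof of Theorem 5.1). Let X ⊆ ℝ^d be nonempty, closed and convex, let f : ℝ^d → ℝ and c : ℝ^d → ℝ^m be differentiable, let x ∈ X, let ρ > 0, and let γ > 0 satisfy d(Dc(x)ᵀc(x), −N_X(x)) ≥ γ‖c(x)‖. Then ‖c(x)‖² ≤ (2/(γ² ρ²)) · ( ‖∇f(x)‖² + d(∇f(x) + ρ Dc(x)ᵀc(x), −N_X(x))² ). -/
open scoped RealInnerProductSpace

/-- Feasibility residual bound from the regularity condition: if
`d(Dc(x)ᵀc(x), −N_X(x)) ≥ γ‖c(x)‖` with `γ > 0` and `ρ > 0`, then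
`‖c(x)‖² ≤ (2/(γ²ρ²)) (‖∇f(x)‖² + d(∇f(x) + ρ Dc(x)ᵀc(x), −N_X(x))²)`. -/
theorem feasibility_residual_bound (d m : ℕ)
    (X : Set (EuclideanSpace ℝ (Fin d)))
    (hXne : X.Nonempty) (hXcl : IsClosed X) (hXconv : Convex ℝ X)
    (f : EuclideanSpace ℝ (Fin d) → ℝ)
    (c : EuclideanSpace ℝ (Fin d) → EuclideanSpace ℝ (Fin m))
    (hf : Differentiable ℝ f) (hc : Differentiable ℝ c)
    (x : EuclideanSpace ℝ (Fin d)) (hx : x ∈ X)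
    (ρ : ℝ) (hρ : 0 < ρ) (γ : ℝ) (hγ : 0 < γ)
    (hreg : γ * ‖c x‖ ≤
      Metric.infDist (ContinuousLinearMap.adjoint (fderiv ℝ c x) (c x)) (-(normalCone X x))) :
    ‖c x‖ ^ 2 ≤ (2 / (γ ^ 2 * ρ ^ 2)) *
      (‖gradient f x‖ ^ 2 +
        (Metric.infDist
          (gradient f x + ρ • ContinuousLinearMap.adjoint (fderiv ℝ c x) (c x))
          (-(normalCone X x))) ^ 2) := by
  set u := ContinuousLinearMap.adjoint (fderiv ℝ c x) (c x) with hu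
  set g := gradient f x with hg
  have hne : (-(normalCone X x)).Nonempty := ⟨0, by simp [normalCone]⟩
  have key : ρ * (γ * ‖c x‖) - ‖g‖ ≤ Metric.infDist (g + ρ • u) (-(normalCone X x)) := by
    rw [Metric.le_infDist hne]
    intro s hs
    have hs' : ρ⁻¹ • s ∈ -(normalCone X x) := by
      intro y hy
      have h1 : ⟪-s, y - x⟫ ≤ 0 := hs y hy
      rw [← smul_neg, real_inner_smul_left]
      exact mul_nonpos_of_nonneg_of_nonpos (inv_pos.mpr hρ).le h1
    have h2 : γ * ‖c x‖ ≤ ‖u - ρ⁻¹ • s‖ := by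
      rw [← dist_eq_norm]
      exact hreg.trans (Metric.infDist_le_dist_of_mem hs')
    have h3 : ρ * ‖u - ρ⁻¹ • s‖ = ‖ρ • u - s‖ := by
      have h : ρ • u - s = ρ • (u - ρ⁻¹ • s) := by
        rw [smul_sub, smul_inv_smul₀ hρ.ne']
      rw [h, norm_smul, Real.norm_of_nonneg hρ.le]
    have h4 : ‖ρ • u - s‖ ≤ ‖g + ρ • u - s‖ + ‖g‖ := by
      have h : ρ • u - s = (g + ρ • u - s) - g := by abel
      rw [h]
      exact norm_sub_le _ _
    have h5 := mul_le_mul_of_nonneg_left h2 hρ.le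
    rw [dist_eq_norm]
    linarith
  set D := Metric.infDist (g + ρ • u) (-(normalCone X x))
  have h0 : 0 ≤ ρ * (γ * ‖c x‖) := by positivity
  have h6 : (ρ * (γ * ‖c x‖)) ^ 2 ≤ (‖g‖ + D) ^ 2 := by
    apply pow_le_pow_left₀ h0
    linarith
  rw [div_mul_eq_mul_div, le_div_iff₀ (by positivity)]
  nlinarith [sq_nonneg (‖g‖ - D)]
end

section
/- Monotonicity of the regularized quadratic form under data augmentation (core matrix fact behind Lemmas A.7 and A.8: the Gaussian-process posterior variance at a point cannot increase when additional observations are added). Let n ≥ 1, let K ∈ ℝ^{n×n} be symmetric positive semidefinite, let v ∈ ℝ^n, let σ > 0, let p ≤ n, and let ι : {1,…,p} → {1,…,n} be injective. Let K_S ∈ ℝ^{p×p} be the principal submatrix (K_S)_{ij} = K_{ι(i)ι(j)} and v_S ∈ ℝ^p the subvector (v_S)_i = v_{ι(i)}. Then v_Sᵀ (K_S + σ² I_p)^{−1} v_S ≤ vᵀ (K + σ² I_n)^{−1} v; equivalently, for any k₀ ∈ ℝ, k₀ − vᵀ(K + σ²I_n)^{−1}v ≤ k₀ − v_Sᵀ(K_S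 + σ²I_p)^{−1}v_S. -/
open Matrix

theorem aux_mono {n p : ℕ} (B : Matrix (Fin n) (Fin n) ℝ) (hB : B.PosDef)
    (v : Fin n → ℝ) (ι : Fin p → Fin n) (hι : Function.Injective ι) :
    (v ∘ ι) ⬝ᵥ ((B.submatrix ι ι)⁻¹).mulVec (v ∘ ι) ≤ v ⬝ᵥ (B⁻¹).mulVec v := by
  have hC : (B.submatrix ι ι).PosDef := hB.submatrix hι
  have hBu : IsUnit B.det := (Matrix.isUnit_iff_isUnit_det _).1 hB.isUnit
  have hCu : IsUnit (B.submatrix ι ι).det := (Matrix.isUnit_iff_isUnit_det _).1 hC.isUnit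
  obtain ⟨P, hP⟩ : ∃ P : Matrix (Fin n) (Fin p) ℝ, P = (1 : Matrix (Fin n) (Fin n) ℝ).submatrix id ι :=
    ⟨_, rfl⟩
  have hPv : ∀ u : Fin n → ℝ, Pᵀ *ᵥ u = u ∘ ι := by
    intro u
    ext i
    simp [hP, Matrix.mulVec, dotProduct, Matrix.one_apply]
  have hPB : Pᵀ * B * P = B.submatrix ι ι := by
    ext i j
    simp [hP, Matrix.mul_apply, Matrix.one_apply]
  obtain ⟨a, ha⟩ : ∃ a, a = B⁻¹ *ᵥ v := ⟨_, rfl⟩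
  obtain ⟨b, hb⟩ : ∃ b, b = (B.submatrix ι ι)⁻¹ *ᵥ (v ∘ ι) := ⟨_, rfl⟩
  rw [← ha, ← hb]
  have hBa : B *ᵥ a = v := by
    rw [ha, Matrix.mulVec_mulVec, Matrix.mul_nonsing_inv _ hBu, Matrix.one_mulVec]
  have hCb : (B.submatrix ι ι) *ᵥ b = v ∘ ι := by
    rw [hb, Matrix.mulVec_mulVec, Matrix.mul_nonsing_inv _ hCu, Matrix.one_mulVec]
  have hT : ∀ u : Fin n → ℝ, (P *ᵥ b) ⬝ᵥ u = (u ∘ ι) ⬝ᵥ b := by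
    intro u
    rw [← hPv, Matrix.mulVec_transpose, ← Matrix.dotProduct_mulVec, dotProduct_comm]
  have h1 : (P *ᵥ b) ⬝ᵥ (B *ᵥ (P *ᵥ b)) = (v ∘ ι) ⬝ᵥ b := by
    rw [hT, ← hPv, Matrix.mulVec_mulVec, Matrix.mulVec_mulVec, hPB, hCb]
  have hBt : Bᵀ = B := by simpa using hB.isHermitian.eq
  have h2 : a ⬝ᵥ (B *ᵥ (P *ᵥ b)) = (v ∘ ι) ⬝ᵥ b := by
    rw [Matrix.dotProduct_mulVec, ← Matrix.mulVec_transpose, hBt, hBa, dotProduct_comm, hT]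
  have h := hB.posSemidef.dotProduct_mulVec_nonneg (a - P *ᵥ b)
  simp only [star_trivial, Matrix.mulVec_sub, sub_dotProduct, dotProduct_sub, hBa, h1, h2, hT] at h
  rw [dotProduct_comm v a]
  linarith

/-- Monotonicity of the regularized quadratic form under data augmentation:
if `K` is an `n×n` real symmetric positive semidefinite matrix, `σ > 0`, and
`K_S`, `v_S` are obtained from `K`, `v` by restricting to an injective index
selection `ι : Fin p → Fin n` (with `p ≤ n`), then
`v_Sᵀ (K_S + σ² I)⁻¹ v_S ≤ vᵀ (K + σ² I)⁻¹ v`; equivalently, for any `k₀`,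
`k₀ − vᵀ(K + σ²I)⁻¹v ≤ k₀ − v_Sᵀ(K_S + σ²I)⁻¹v_S`. -/
theorem regularized_quadratic_form_monotone (n p : ℕ) (hn : 1 ≤ n) (hp : p ≤ n)
    (K : Matrix (Fin n) (Fin n) ℝ) (hK : K.PosSemidef)
    (v : Fin n → ℝ) (σ : ℝ) (hσ : 0 < σ)
    (ι : Fin p → Fin n) (hι : Function.Injective ι) :
    (v ∘ ι) ⬝ᵥ ((K.submatrix ι ι + σ ^ 2 • (1 : Matrix (Fin p) (Fin p) ℝ))⁻¹).mulVec (v ∘ ι)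
        ≤ v ⬝ᵥ ((K + σ ^ 2 • (1 : Matrix (Fin n) (Fin n) ℝ))⁻¹).mulVec v ∧
      ∀ k₀ : ℝ,
        k₀ - v ⬝ᵥ ((K + σ ^ 2 • (1 : Matrix (Fin n) (Fin n) ℝ))⁻¹).mulVec v
          ≤ k₀ - (v ∘ ι) ⬝ᵥ
              ((K.submatrix ι ι + σ ^ 2 • (1 : Matrix (Fin p) (Fin p) ℝ))⁻¹).mulVec (v ∘ ι) := by
  have hB : (K + σ ^ 2 • (1 : Matrix (Fin n) (Fin n) ℝ)).PosDef :=
    Matrix.PosDef.posSemidef_add hK (Matrix.PosDef.one.smul (by positivity))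
  have h := aux_mono _ hB v ι hι
  have e : (K + σ ^ 2 • (1 : Matrix (Fin n) (Fin n) ℝ)).submatrix ι ι
      = K.submatrix ι ι + σ ^ 2 • (1 : Matrix (Fin p) (Fin p) ℝ) := by
    ext i j
    simp [Matrix.one_apply, hι.eq_iff]
  rw [e] at h
  exact ⟨h, fun k₀ => sub_le_sub_left h k₀⟩
end
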